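/- Let N ≥ 2 and let q ∈ ℂ be a primitive 4N-th root of unity with q^N = i. Let ν = (ν₁ > … > ν_ℓ > 0) be a strict partition with ν₁ < N such that every part satisfies ν_k > 3N/4 or ν_k < N/4, and let j be the smallest index with ν_j < N/4 (j = ℓ+1 if no such index exists). Set λ := (ν_j, ν_{j+1}, …, ν_ℓ) and μ := (N − ν_{j−1}, N − ν_{j−2}, …, N − ν₁). Then q_ν = q_λ · q_μ · ∏_{r=1}^{ℓ(λ)} ∏_{s=1}^{ℓ(μ)} (q^{λ_r + μ_s} + q^{−λ_r − μ_s})/(q^{λ_r − μ_s} + q^{μ_s − λ_r}). -/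

import Mathlib

noncomputable section

/-- The quantum integer `[k] = (q^k - q^{-k})/(q - q⁻¹)`. -/
def qnum (q : ℂ) (k : ℤ) : ℂ := (q ^ k - q ^ (-k)) / (q - q⁻¹)

/-- The one-row quantity `q_{(m)} = ∏_{j=1}^m i (q^{j-1} + q^{1-j})/(q^j - q^{-j})`. -/
def qrow (q : ℂ) (m : ℕ) : ℂ :=
  ∏ j ∈ Finset.Icc 1 m,
    Complex.I * (q ^ ((j : ℤ) - 1) + q ^ (1 - (j : ℤ))) / (q ^ (j : ℤ) - q ^ (-(j : ℤ)))

/-- The quantity `q_λ` attached to a strict partition `λ = (λ₁ > … > λ_r > 0)`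
(given as a function `Fin r → ℕ`):
`q_λ = ∏_j q_{(λ_j)} ∏_{i<j} [λ_i - λ_j]/[λ_i + λ_j]`. -/
def qpart (q : ℂ) {r : ℕ} (lam : Fin r → ℕ) : ℂ :=
  (∏ j, qrow q (lam j)) *
    ∏ p ∈ Finset.univ.filter (fun p : Fin r × Fin r => p.1 < p.2),
      qnum q ((lam p.1 : ℤ) - (lam p.2 : ℤ)) / qnum q ((lam p.1 : ℤ) + (lam p.2 : ℤ))

end

lemma zpow_ne_one_of_isPrimitiveRoot {M : ℕ} {q : ℂ} (hq : IsPrimitiveRoot q M) {k : ℤ}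
    (h0 : 0 < k) (h1 : k < M) : q ^ k ≠ 1 := by
  intro h
  have := Int.le_of_dvd h0 ((hq.zpow_eq_one_iff_dvd k).1 h)
  omega

section RootOfUnity

variable {N : ℕ} {q : ℂ}

lemma zpow_sub_neg_of_pow_eq_I (h0 : q ≠ 0) (hqN : q ^ N = Complex.I) (k : ℤ) :
    q ^ ((N : ℤ) - k) - q ^ (-((N : ℤ) - k)) = Complex.I * (q ^ k + q ^ (-k)) := by
  rw [neg_sub, zpow_sub₀ h0, zpow_sub₀ h0, zpow_natCast, hqN, zpow_neg, div_eq_mul_inv,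
    div_eq_mul_inv, Complex.inv_I]
  ring

lemma zpow_add_neg_of_pow_eq_I (h0 : q ≠ 0) (hqN : q ^ N = Complex.I) (k : ℤ) :
    q ^ ((N : ℤ) - k) + q ^ (-((N : ℤ) - k)) = -Complex.I * (q ^ k - q ^ (-k)) := by
  rw [neg_sub, zpow_sub₀ h0, zpow_sub₀ h0, zpow_natCast, hqN, zpow_neg, div_eq_mul_inv,
    div_eq_mul_inv, Complex.inv_I]
  ring

lemma zpow_sub_zpow_neg_ne_zero (h0 : q ≠ 0) (hq : IsPrimitiveRoot q (4 * N)) {k : ℤ}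
    (hk : 0 < k) (hkN : k ≤ N) : q ^ k - q ^ (-k) ≠ 0 := by
  intro h
  refine zpow_ne_one_of_isPrimitiveRoot hq (k := k + k) (by omega) (by push_cast; omega) ?_
  rw [zpow_add₀ h0]
  nth_rewrite 1 [sub_eq_zero.1 h]
  rw [← zpow_add₀ h0, neg_add_cancel, zpow_zero]

lemma zpow_add_zpow_neg_ne_zero (h0 : q ≠ 0) (hq : IsPrimitiveRoot q (4 * N))
    (hqN : q ^ N = Complex.I) {k : ℤ} (hk : 0 ≤ k) (hkN : k < N) : q ^ k + q ^ (-k) ≠ 0 := by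
  have h := zpow_sub_zpow_neg_ne_zero h0 hq (k := N - k) (by omega) (by omega)
  rw [zpow_sub_neg_of_pow_eq_I h0 hqN] at h
  exact right_ne_zero_of_mul h

/-- The `j`-th factor of `qrow`. -/
noncomputable def qrowFactor (q : ℂ) (j : ℕ) : ℂ :=
  Complex.I * (q ^ ((j : ℤ) - 1) + q ^ (1 - (j : ℤ))) / (q ^ (j : ℤ) - q ^ (-(j : ℤ)))

lemma qrow_succ (q : ℂ) (m : ℕ) : qrow q (m + 1) = qrow q m * qrowFactor q (m + 1) :=
  Finset.prod_Icc_succ_top (by omega) _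

lemma qrowFactor_mul_qrowFactor (h0 : q ≠ 0) (hq : IsPrimitiveRoot q (4 * N))
    (hqN : q ^ N = Complex.I) {a b : ℕ} (hab : a + b + 1 = N) :
    qrowFactor q (a + 1) * qrowFactor q (b + 1) = 1 := by
  have hs := zpow_sub_neg_of_pow_eq_I h0 hqN a
  have ha := zpow_add_neg_of_pow_eq_I h0 hqN (a + 1)
  have n1 := zpow_sub_zpow_neg_ne_zero h0 hq (k := a + 1) (by omega) (by omega)
  have n2 := zpow_add_zpow_neg_ne_zero h0 hq hqN (k := a) (by omega) (by omega)
  have e1 : (N : ℤ) - a = b + 1 := by omega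
  have e2 : (N : ℤ) - (a + 1) = b := by omega
  rw [e1] at hs
  rw [e2] at ha
  have e3 : (1 : ℤ) - (a + 1) = -a := by ring
  have e4 : (1 : ℤ) - (b + 1) = -b := by ring
  simp only [qrowFactor, Nat.cast_add, Nat.cast_one, add_sub_cancel_right, e3, e4]
  rw [hs, ha]
  field_simp
  linear_combination -Complex.I_sq

lemma qrowFactor_middle (h0 : q ≠ 0) (hq : IsPrimitiveRoot q (4 * N))
    (hqN : q ^ N = Complex.I) {a : ℕ} (ha : 2 * a + 1 = N) : qrowFactor q (a + 1) = 1 := by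
  have hs := zpow_sub_neg_of_pow_eq_I h0 hqN a
  have n2 := zpow_add_zpow_neg_ne_zero h0 hq hqN (k := a) (by omega) (by omega)
  have e1 : (N : ℤ) - a = a + 1 := by omega
  rw [e1] at hs
  have e3 : (1 : ℤ) - (a + 1) = -a := by ring
  simp only [qrowFactor, Nat.cast_add, Nat.cast_one, add_sub_cancel_right, e3]
  rw [hs]
  exact div_self (mul_ne_zero Complex.I_ne_zero n2)

lemma qrow_add_eq (h0 : q ≠ 0) (hq : IsPrimitiveRoot q (4 * N)) (hqN : q ^ N = Complex.I)
    (d : ℕ) : ∀ a : ℕ, 2 * a + d = N → qrow q (a + d) = qrow q a := by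
  induction d using Nat.twoStepInduction with
  | zero => intro a _; rfl
  | one =>
    intro a ha
    rw [qrow_succ, qrowFactor_middle h0 hq hqN ha, mul_one]
  | more d ih _ =>
    intro a ha
    have h := ih (a + 1) (by omega)
    have e : a + (d + 2) = (a + 1 + d) + 1 := by omega
    rw [e, qrow_succ, h, qrow_succ, mul_assoc,
      qrowFactor_mul_qrowFactor h0 hq hqN (by omega), mul_one]

lemma qrow_eq_of_add_eq (h0 : q ≠ 0) (hq : IsPrimitiveRoot q (4 * N))
    (hqN : q ^ N = Complex.I) {a b : ℕ} (hab : a + b = N) : qrow q a = qrow q b := by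
  rcases le_total a b with h | h <;> obtain ⟨d, rfl⟩ := Nat.exists_eq_add_of_le h
  · exact (qrow_add_eq h0 hq hqN d a (by omega)).symm
  · exact qrow_add_eq h0 hq hqN d b (by omega)

/-- The quotient `[a - b]/[a + b]`. -/
noncomputable def qquot (q : ℂ) (a b : ℕ) : ℂ := qnum q ((a : ℤ) - b) / qnum q ((a : ℤ) + b)

lemma qpart_eq_prod_prod (q : ℂ) {r : ℕ} (lam : Fin r → ℕ) :
    qpart q lam = (∏ i, qrow q (lam i)) *
      ∏ a, ∏ b, if a < b then qquot q (lam a) (lam b) else 1 := by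
  rw [qpart, Finset.prod_filter, Fintype.prod_prod_type]
  rfl

lemma qnum_two_mul_sub (h0 : q ≠ 0) (hqN : q ^ N = Complex.I) (k : ℤ) :
    qnum q (2 * N - k) = qnum q k := by
  have hs := zpow_sub_neg_of_pow_eq_I h0 hqN (k - N)
  have e1 : (N : ℤ) - (k - N) = 2 * N - k := by ring
  have hb := zpow_add_neg_of_pow_eq_I h0 hqN k
  rw [e1, show k - (N : ℤ) = -(N - k) by ring, neg_neg, add_comm, hb] at hs
  rw [qnum, hs, qnum]
  linear_combination (-(q ^ k - q ^ (-k)) / (q - q⁻¹)) * Complex.I_sq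

lemma qquot_sub_sub (h0 : q ≠ 0) (hqN : q ^ N = Complex.I) {a b : ℕ} (ha : a ≤ N) (hb : b ≤ N) :
    qquot q (N - a) (N - b) = qquot q b a := by
  rw [qquot, qquot, ← qnum_two_mul_sub h0 hqN ((b : ℤ) + a)]
  congr 2 <;> omega

lemma qquot_sub_left (h0 : q ≠ 0) (hq1 : q - q⁻¹ ≠ 0) (hqN : q ^ N = Complex.I) {a b : ℕ}
    (ha : a ≤ N) :
    qquot q (N - a) b = (q ^ ((b : ℤ) + a) + q ^ (-((b : ℤ) + a))) /
      (q ^ ((b : ℤ) - a) + q ^ ((a : ℤ) - b)) := by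
  have h1 := zpow_sub_neg_of_pow_eq_I h0 hqN (b + a)
  have h2 := zpow_sub_neg_of_pow_eq_I h0 hqN (a - b)
  have e1 : ((N - a : ℕ) : ℤ) - b = N - (b + a) := by omega
  have e2 : ((N - a : ℕ) : ℤ) + b = N - (a - b) := by omega
  rw [qquot, e1, e2, qnum, qnum, h1, h2, div_div_div_cancel_right₀ hq1,
    mul_div_mul_left _ _ Complex.I_ne_zero, neg_sub, add_comm (q ^ ((a : ℤ) - b))]

lemma qpart_eq_of_split (h0 : q ≠ 0) (hq1 : q - q⁻¹ ≠ 0) (hq : IsPrimitiveRoot q (4 * N))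
    (hqN : q ^ N = Complex.I) {j k : ℕ} (ν : Fin (j + k) → ℕ) (hlt : ∀ i, ν i < N)
    (lam : Fin k → ℕ) (mu : Fin j → ℕ) (hlam : ∀ i, lam i = ν (Fin.natAdd j i))
    (hmu : ∀ s, mu s = N - ν (Fin.castAdd k s.rev)) :
    qpart q ν = qpart q lam * qpart q mu *
      ∏ r, ∏ s, (q ^ ((lam r : ℤ) + mu s) + q ^ (-((lam r : ℤ) + mu s))) /
        (q ^ ((lam r : ℤ) - mu s) + q ^ ((mu s : ℤ) - lam r)) := by
  have hmuN : ∀ s, mu s ≤ N := fun s => by rw [hmu]; omega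
  have hhigh : ∀ s, ν (Fin.castAdd k s) = N - mu s.rev := fun s => by
    have := hlt (Fin.castAdd k s)
    rw [hmu, Fin.rev_rev]
    omega
  have hrow : ∏ s, qrow q (ν (Fin.castAdd k s)) = ∏ s, qrow q (mu s) := by
    rw [← Equiv.prod_comp Fin.revPerm fun s => qrow q (mu s)]
    refine Finset.prod_congr rfl fun s _ => qrow_eq_of_add_eq h0 hq hqN ?_
    have := hmuN s.rev
    rw [hhigh, Fin.revPerm_apply]
    omega
  have hpairs : (∏ a, ∏ b, if a < b then
        qquot q (ν (Fin.castAdd k a)) (ν (Fin.castAdd k b)) else 1) =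
      ∏ a, ∏ b, if a < b then qquot q (mu a) (mu b) else 1 := by
    rw [Finset.prod_comm, ← Equiv.prod_comp Fin.revPerm]
    refine Finset.prod_congr rfl fun a _ => ?_
    rw [← Equiv.prod_comp Fin.revPerm]
    refine Finset.prod_congr rfl fun b _ => ?_
    simp only [Fin.revPerm_apply, Fin.rev_lt_rev, hhigh, Fin.rev_rev,
      qquot_sub_sub h0 hqN (hmuN _) (hmuN _)]
  have hcross : (∏ s, ∏ r, qquot q (ν (Fin.castAdd k s)) (lam r)) =
      ∏ r, ∏ s, (q ^ ((lam r : ℤ) + mu s) + q ^ (-((lam r : ℤ) + mu s))) /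
        (q ^ ((lam r : ℤ) - mu s) + q ^ ((mu s : ℤ) - lam r)) := by
    rw [Finset.prod_comm]
    refine Finset.prod_congr rfl fun r _ => ?_
    rw [← Equiv.prod_comp Fin.revPerm]
    refine Finset.prod_congr rfl fun s _ => ?_
    rw [hhigh, Fin.revPerm_apply, Fin.rev_rev, qquot_sub_left h0 hq1 hqN (hmuN s)]
  have hlt' : ∀ (s : Fin j) (r : Fin k), Fin.castAdd k s < Fin.natAdd j r := fun s r => by
    simp only [Fin.lt_def, Fin.val_castAdd, Fin.val_natAdd]
    omega
  simp only [qpart_eq_prod_prod, Fin.prod_univ_add, Finset.prod_mul_distrib, hlt', if_true,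
    (hlt' _ _).not_gt, if_false, Finset.prod_const_one,
    (Fin.strictMono_castAdd k).lt_iff_lt, (Fin.strictMono_natAdd j).lt_iff_lt,
    hrow, hpairs, hcross, ← hlam]
  ring

end RootOfUnity

/-- let `q` be a primitive `4N`-th root of unity with `q^N = i`, and let
`ν` be a strict partition with `ν₁ < N` all of whose parts satisfy `ν_k > 3N/4` or
`ν_k < N/4`; let `j` be the smallest index with `ν_j < N/4` (so all earlier parts
are `> 3N/4` and all later parts are `< N/4`).  With
`λ = (ν_j, …, ν_ℓ)` and `μ = (N - ν_{j-1}, …, N - ν₁)` one has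
`q_ν = q_λ q_μ ∏_{r,s} (q^{λ_r+μ_s} + q^{-λ_r-μ_s})/(q^{λ_r-μ_s} + q^{μ_s-λ_r})`. -/
theorem qpart_factorization (N : ℕ) (hN : 2 ≤ N) (q : ℂ)
    (hq : IsPrimitiveRoot q (4 * N)) (hqN : q ^ N = Complex.I)
    (l : ℕ) (ν : Fin l → ℕ)
    (hstrict : ∀ i j : Fin l, i < j → ν j < ν i) (hpos : ∀ i, 0 < ν i)
    (hlt : ∀ i, ν i < N)
    (j : ℕ) (hj : j ≤ l)
    (hhigh : ∀ i : Fin l, (i : ℕ) < j → 3 * N < 4 * ν i)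
    (hlow : ∀ i : Fin l, j ≤ (i : ℕ) → 4 * ν i < N)
    (lam : Fin (l - j) → ℕ) (mu : Fin j → ℕ)
    (hlam : ∀ i : Fin (l - j), lam i = ν ⟨j + (i : ℕ), by have := i.2; omega⟩)
    (hmu : ∀ s : Fin j, mu s = N - ν ⟨j - 1 - (s : ℕ), by have := s.2; omega⟩) :
    qpart q ν =
      qpart q lam * qpart q mu *
        ∏ r : Fin (l - j), ∏ s : Fin j,
          (q ^ ((lam r : ℤ) + (mu s : ℤ)) + q ^ (-((lam r : ℤ) + (mu s : ℤ)))) /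
            (q ^ ((lam r : ℤ) - (mu s : ℤ)) + q ^ ((mu s : ℤ) - (lam r : ℤ))) := by
  have h0 : q ≠ 0 := hq.ne_zero (by omega)
  have hq1 : q - q⁻¹ ≠ 0 := by
    simpa using zpow_sub_zpow_neg_ne_zero h0 hq (k := 1) one_pos (by omega)
  obtain ⟨k, rfl⟩ := Nat.exists_eq_add_of_le hj
  have key : ∀ m (hm : m = k) (lam : Fin m → ℕ),
      (∀ i, lam i = ν ⟨j + (i : ℕ), by have := i.2; omega⟩) →
      qpart q ν = qpart q lam * qpart q mu *
        ∏ r : Fin m, ∏ s : Fin j,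
          (q ^ ((lam r : ℤ) + (mu s : ℤ)) + q ^ (-((lam r : ℤ) + (mu s : ℤ)))) /
            (q ^ ((lam r : ℤ) - (mu s : ℤ)) + q ^ ((mu s : ℤ) - (lam r : ℤ))) := by
    rintro m rfl lam hlam
    refine qpart_eq_of_split h0 hq1 hq hqN ν hlt lam mu hlam fun s => ?_
    rw [hmu]
    congr 3
    simp only [Fin.val_rev]
    omega
  exact key _ (by omega) lam hlam
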